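/- arXiv:0906.4660 — 6 statements merged into one kernel-verified Lean document; each statement's English description precedes it below -/
import Mathlib

section
/- Theorem 4.1: let q, h, a, σ, κ be a Frenet frame of a spacelike ruled surface of type M₊², let c : ℝ → ℝ³ be a smooth striction curve, i.e. ⟨c'(s), h(s)⟩ = 0 for all s, let R : ℝ → ℝ be smooth, and set c*(s) = c(s) + R(s) a(s). Assume the Mannheim offset striction condition ⟨c*'(s), a(s)⟩ = 0 for all s. Then the surface φ(s,v) = c(s) + v q(s) is developable, i.e. det(c'(s), q(s), q'(s)) = 0 for all s, if and only if R is constant. -/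
noncomputable section

/-- The Minkowski bilinear form on ℝ³: ⟨x,y⟩ = -x₁y₁ + x₂y₂ + x₃y₃. -/
def mink (x y : Fin 3 → ℝ) : ℝ := -(x 0 * y 0) + x 1 * y 1 + x 2 * y 2

/-- The Minkowski norm ‖v‖ = √|⟨v,v⟩|. -/
def mnorm (v : Fin 3 → ℝ) : ℝ := Real.sqrt |mink v v|

/-- The determinant of three vectors in ℝ³. -/
def det3 (u v w : Fin 3 → ℝ) : ℝ :=
  u 0 * (v 1 * w 2 - v 2 * w 1) - u 1 * (v 0 * w 2 - v 2 * w 0)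
    + u 2 * (v 0 * w 1 - v 1 * w 0)

/-- A Frenet frame of a spacelike ruled surface of type M₊² in Minkowski 3-space:
orthonormal fields `q` (spacelike ruling), `h` (timelike central normal),
`a` (spacelike asymptotic normal), with `σ = ds₁/ds > 0` and conical curvature `κ`,
satisfying the Frenet equations q' = σh, h' = σ(q + κa), a' = σκh. -/
structure FrenetFrameM2 where
  q : ℝ → Fin 3 → ℝ
  h : ℝ → Fin 3 → ℝ
  a : ℝ → Fin 3 → ℝ
  σ : ℝ → ℝ
  κ : ℝ → ℝ
  smooth_q : ContDiff ℝ (⊤ : ℕ∞) q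
  smooth_h : ContDiff ℝ (⊤ : ℕ∞) h
  smooth_a : ContDiff ℝ (⊤ : ℕ∞) a
  smooth_σ : ContDiff ℝ (⊤ : ℕ∞) σ
  smooth_κ : ContDiff ℝ (⊤ : ℕ∞) κ
  hqq : ∀ s, mink (q s) (q s) = 1
  hhh : ∀ s, mink (h s) (h s) = -1
  haa : ∀ s, mink (a s) (a s) = 1
  hqh : ∀ s, mink (q s) (h s) = 0
  hqa : ∀ s, mink (q s) (a s) = 0
  hha : ∀ s, mink (h s) (a s) = 0
  σ_pos : ∀ s, 0 < σ s
  frenet_q : ∀ s, deriv q s = σ s • h s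
  frenet_h : ∀ s, deriv h s = σ s • (q s + κ s • a s)
  frenet_a : ∀ s, deriv a s = (σ s * κ s) • h s

/-- Gram identity: the product of two determinants is minus the determinant of the matrix of
Minkowski products. -/
lemma det3_mul_det3 (u v w x y z : Fin 3 → ℝ) :
    det3 u v w * det3 x y z =
      -(mink u x * (mink v y * mink w z - mink v z * mink w y)
        - mink u y * (mink v x * mink w z - mink v z * mink w x)
        + mink u z * (mink v x * mink w y - mink v y * mink w x)) := by
  simp only [det3, mink]
  ring

lemma mink_comm (x y : Fin 3 → ℝ) : mink x y = mink y x := by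
  simp only [mink]
  ring

lemma mink_add_left (x y z : Fin 3 → ℝ) : mink (x + y) z = mink x z + mink y z := by
  simp only [mink, Pi.add_apply]
  ring

lemma mink_smul_left (r : ℝ) (x y : Fin 3 → ℝ) : mink (r • x) y = r * mink x y := by
  simp only [mink, Pi.smul_apply, smul_eq_mul]
  ring

lemma det3_smul_right (r : ℝ) (u v w : Fin 3 → ℝ) : det3 u v (r • w) = r * det3 u v w := by
  simp only [det3, Pi.smul_apply, smul_eq_mul]
  ring

namespace FrenetFrameM2

lemma det3_mul_det3_frame (F : FrenetFrameM2) (u : Fin 3 → ℝ) (s : ℝ) :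
    det3 u (F.q s) (F.h s) * det3 (F.a s) (F.q s) (F.h s) = mink u (F.a s) := by
  rw [det3_mul_det3, F.hqq, F.hhh, F.hqh, F.hqa, F.hha, mink_comm (F.h s) (F.q s), F.hqh]
  ring

lemma det3_deriv_q_eq_zero_iff (F : FrenetFrameM2) (u : Fin 3 → ℝ) (s : ℝ) :
    det3 u (F.q s) (deriv F.q s) = 0 ↔ mink u (F.a s) = 0 := by
  have hne : det3 (F.a s) (F.q s) (F.h s) ≠ 0 := by
    intro h0
    have h1 := F.det3_mul_det3_frame (F.a s) s
    rw [h0, F.haa] at h1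
    norm_num at h1
  rw [F.frenet_q, det3_smul_right, ← F.det3_mul_det3_frame u s]
  simp [hne, (F.σ_pos s).ne']

lemma mink_deriv_offset (F : FrenetFrameM2) {c : ℝ → Fin 3 → ℝ} {R : ℝ → ℝ} {s : ℝ}
    (hc : DifferentiableAt ℝ c s) (hR : DifferentiableAt ℝ R s) :
    mink (deriv (fun t => c t + R t • F.a t) s) (F.a s) =
      mink (deriv c s) (F.a s) + deriv R s := by
  have ha : DifferentiableAt ℝ F.a s := F.smooth_a.differentiable (by simp) s
  have hd := (hc.hasDerivAt.add (hR.hasDerivAt.smul ha.hasDerivAt)).deriv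
  change deriv (fun t => c t + R t • F.a t) s = _ at hd
  rw [hd, F.frenet_a]
  simp only [mink_add_left, mink_smul_left, F.haa, F.hha]
  ring

end FrenetFrameM2

/-- Theorem 4.1: if the timelike ruled surface with striction curve c* = c + R a is a
Mannheim offset of the spacelike ruled surface φ(s,v) = c(s) + v q(s) of type M₊²,
then φ is developable iff R is constant. -/
theorem mannheim_offset_developable_iff_R_const (F : FrenetFrameM2)
    (c : ℝ → Fin 3 → ℝ) (hc : ContDiff ℝ (⊤ : ℕ∞) c)
    (hstriction : ∀ s, mink (deriv c s) (F.h s) = 0)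
    (R : ℝ → ℝ) (hR : ContDiff ℝ (⊤ : ℕ∞) R)
    (hoffset : ∀ s, mink (deriv (fun t => c t + R t • F.a t) s) (F.a s) = 0) :
    (∀ s, det3 (deriv c s) (F.q s) (deriv F.q s) = 0) ↔ (∀ s t, R s = R t) := by
  have hRd : Differentiable ℝ R := hR.differentiable (by simp)
  have key : ∀ s, mink (deriv c s) (F.a s) + deriv R s = 0 := fun s => by
    rw [← F.mink_deriv_offset (hc.differentiable (by simp) s) (hRd s)]
    exact hoffset s
  simp only [F.det3_deriv_q_eq_zero_iff]
  constructor
  · exact fun h => is_const_of_deriv_eq_zero hRd fun s => by linarith [key s, h s]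
  · intro h s
    have hR' : deriv R s = 0 := by
      rw [funext fun t => h t 0]
      exact deriv_const s (R 0)
    linarith [key s]
end
end

section
/- Theorem 5.1 (i): let q, h, a, σ, κ be a Frenet frame of a spacelike ruled surface of type M₊², let c : ℝ → ℝ³ be smooth with c'(s) = q(s) for all s, let R be a nonzero real constant, let θ : ℝ → ℝ be smooth, and set c*(s) = c(s) + R a(s) and q*(s) = sinh θ(s) q(s) + cosh θ(s) h(s) (the timelike ruling of a Mannheim offset of type M₋¹). Then there exists a function μ : ℝ → ℝ with c*'(s) = μ(s) q*(s) for all s (i.e. the offset is developable) if and only if cosh θ(s) - R κ(s) σ(s) sinh θ(s) = 0 for all s. -/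
noncomputable section

theorem mink_smul_add_smul_left (x y : ℝ) (u v w : Fin 3 → ℝ) :
    mink (x • u + y • v) w = x * mink u w + y * mink v w := by
  simp only [mink, Pi.add_apply, Pi.smul_apply, smul_eq_mul]
  ring

theorem mink_comm_s9 (u v : Fin 3 → ℝ) : mink u v = mink v u := by
  simp only [mink]
  ring

namespace FrenetFrameM2

/-- Coordinates with respect to the ruling and the central normal are unique. -/
theorem smul_q_add_smul_h_inj (F : FrenetFrameM2) (s : ℝ) {x y x' y' : ℝ} :
    x • F.q s + y • F.h s = x' • F.q s + y' • F.h s ↔ x = x' ∧ y = y' := by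
  refine ⟨fun e => ?_, fun ⟨hx, hy⟩ => by rw [hx, hy]⟩
  have eq := congrArg (mink · (F.q s)) e
  have eh := congrArg (mink · (F.h s)) e
  simp only [mink_smul_add_smul_left, mink_comm_s9 (F.h s) (F.q s), F.hqq, F.hhh, F.hqh] at eq eh
  exact ⟨by linarith, by linarith⟩

/-- The velocity of the offset curve `c + R a` of a curve with tangent `q`. -/
theorem deriv_add_smul_a (F : FrenetFrameM2) {c : ℝ → Fin 3 → ℝ} {s : ℝ}
    (hc : DifferentiableAt ℝ c s) (hcq : deriv c s = F.q s) (R : ℝ) :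
    deriv (fun t => c t + R • F.a t) s = (1 : ℝ) • F.q s + (R * F.κ s * F.σ s) • F.h s := by
  have ha : DifferentiableAt ℝ F.a s := (F.smooth_a.differentiable (by simp)).differentiableAt
  rw [deriv_fun_add hc (ha.fun_const_smul R), deriv_fun_const_smul R ha, hcq, F.frenet_a,
    smul_smul, one_smul]
  congr 2
  ring

end FrenetFrameM2

/-- The vector `(1, m)` is a multiple of `(sinh t, cosh t)` iff their determinant vanishes. -/
theorem exists_mul_sinh_cosh_iff (t m : ℝ) :
    (∃ μ : ℝ, 1 = μ * Real.sinh t ∧ m = μ * Real.cosh t) ↔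
      Real.cosh t - m * Real.sinh t = 0 := by
  constructor
  · rintro ⟨μ, h1, hm⟩
    rw [hm]
    linear_combination Real.cosh t * h1
  · intro e
    have hs : Real.sinh t ≠ 0 := fun hs => (Real.cosh_pos t).ne' (by simpa [hs] using e)
    refine ⟨(Real.sinh t)⁻¹, (inv_mul_cancel₀ hs).symm, ?_⟩
    field_simp
    linarith

/-- Theorem 5.1 (i): the Mannheim offset of type M₋¹, with striction curve c + R a and
ruling q* = sinh θ q + cosh θ h, of a developable spacelike ruled surface of type M₊²
is developable iff cosh θ - Rκσ sinh θ = 0. -/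
theorem mannheim_offset_M1minus_developable_iff (F : FrenetFrameM2)
    (c : ℝ → Fin 3 → ℝ) (hc : ContDiff ℝ (⊤ : ℕ∞) c)
    (hcq : ∀ s, deriv c s = F.q s)
    (R : ℝ) (hR : R ≠ 0) (θ : ℝ → ℝ) (hθ : ContDiff ℝ (⊤ : ℕ∞) θ) :
    (∃ μ : ℝ → ℝ, ∀ s, deriv (fun t => c t + R • F.a t) s
        = μ s • (Real.sinh (θ s) • F.q s + Real.cosh (θ s) • F.h s)) ↔
      (∀ s, Real.cosh (θ s) - R * F.κ s * F.σ s * Real.sinh (θ s) = 0) := by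
  rw [← Classical.skolem (p := fun s μ => deriv (fun t => c t + R • F.a t) s
    = μ • (Real.sinh (θ s) • F.q s + Real.cosh (θ s) • F.h s))]
  refine forall_congr' fun s => ?_
  rw [← exists_mul_sinh_cosh_iff,
    F.deriv_add_smul_a (hc.differentiable (by simp)).differentiableAt (hcq s) R]
  simp only [smul_add, smul_smul, F.smul_q_add_smul_h_inj]
end
end

section
/- Theorem 5.2, necessity: let q, h, a, σ, κ be a Frenet frame of a spacelike ruled surface of type M₊², let R be a nonzero real constant, and let θ : ℝ → ℝ be smooth with θ(s) ≠ 0 for all s, satisfying θ'(s) = -σ(s) and R κ(s) σ(s) = coth θ(s) for all s (the conditions that the ruled surface with base c + R a and ruling sinh θ q + cosh θ h is a developable Mannheim offset). Then the conical curvature satisfies the differential equation κ'(s) = (1/R)(R² κ(s)² σ(s)² - 1) - (σ'(s)/σ(s)) κ(s) for all s. -/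
noncomputable section

/-- The chain rule for the hyperbolic cotangent, in the form `coth' = 1 - coth²`. -/
theorem hasDerivAt_coth_comp {θ : ℝ → ℝ} {θ' s : ℝ} (hθ : HasDerivAt θ θ' s) (h0 : θ s ≠ 0) :
    HasDerivAt (fun t => Real.cosh (θ t) / Real.sinh (θ t))
      ((1 - (Real.cosh (θ s) / Real.sinh (θ s)) ^ 2) * θ') s := by
  have hsinh : Real.sinh (θ s) ≠ 0 := Real.sinh_ne_zero.mpr h0
  refine (hθ.cosh.div hθ.sinh hsinh).congr_deriv ?_
  field_simp

/-- Theorem 5.2, necessity: if a developable Mannheim offset of type M₋¹ exists, i.e.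
θ' = -σ and Rκσ = coth θ, then κ' = (1/R)(R²κ²σ² - 1) - (σ'/σ)κ. -/
theorem mannheim_offset_curvature_ode (F : FrenetFrameM2)
    (R : ℝ) (hR : R ≠ 0) (θ : ℝ → ℝ) (hθ : ContDiff ℝ (⊤ : ℕ∞) θ)
    (hθ0 : ∀ s, θ s ≠ 0)
    (hθ' : ∀ s, deriv θ s = -F.σ s)
    (hcoth : ∀ s, R * F.κ s * F.σ s = Real.cosh (θ s) / Real.sinh (θ s)) :
    ∀ s, deriv F.κ s
      = (1 / R) * (R ^ 2 * F.κ s ^ 2 * F.σ s ^ 2 - 1) - (deriv F.σ s / F.σ s) * F.κ s := by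
  intro s
  have hσ : F.σ s ≠ 0 := (F.σ_pos s).ne'
  have dκ : HasDerivAt F.κ (deriv F.κ s) s :=
    (F.smooth_κ.differentiable (by simp) s).hasDerivAt
  have dσ : HasDerivAt F.σ (deriv F.σ s) s :=
    (F.smooth_σ.differentiable (by simp) s).hasDerivAt
  have dθ : HasDerivAt θ (-F.σ s) s :=
    hθ' s ▸ (hθ.differentiable (by simp) s).hasDerivAt
  have hcothDeriv := hasDerivAt_coth_comp dθ (hθ0 s)
  rw [← funext hcoth, ← hcoth s] at hcothDeriv
  have key := ((dκ.const_mul R).mul dσ).unique hcothDeriv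
  field_simp
  linear_combination key
end
end

section
/- Theorem 5.2, sufficiency: let q, h, a, σ, κ be a Frenet frame of a spacelike ruled surface of type M₊², let c : ℝ → ℝ³ be smooth with c'(s) = q(s) for all s, let R be a nonzero real constant, and assume R² κ(s)² σ(s)² > 1 for all s and that κ'(s) = (1/R)(R² κ(s)² σ(s)² - 1) - (σ'(s)/σ(s)) κ(s) for all s. Set c*(s) = c(s) + R a(s) and q*(s) = (q(s) + R σ(s) κ(s) h(s)) / √(R² σ(s)² κ(s)² - 1). Then q* is a unit timelike field (⟨q*,q*⟩ = -1), c*'(s) is a scalar multiple of q*(s), and for every s the derivative q*'(s) is a scalar multiple of a(s); hence the developable timelike ruled surface φ*(s,v) = c*(s) + v q*(s) of type M₋¹ is a Mannheim offset of the spacelike ruled surface φ(s,v) = c(s) + v q(s). -/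
noncomputable section

/-- The product `σκ` of a frame, scaled by `R`, satisfies a Riccati equation. -/
lemma FrenetFrameM2.hasDerivAt_riccati (F : FrenetFrameM2) {R s : ℝ} (hR : R ≠ 0)
    (hode : deriv F.κ s
      = (1 / R) * (R ^ 2 * F.κ s ^ 2 * F.σ s ^ 2 - 1) - (deriv F.σ s / F.σ s) * F.κ s) :
    HasDerivAt (fun t => R * F.σ t * F.κ t) (F.σ s * ((R * F.σ s * F.κ s) ^ 2 - 1)) s := by
  have hσ := (F.smooth_σ.differentiable (by simp) s).hasDerivAt
  have hκ := (F.smooth_κ.differentiable (by simp) s).hasDerivAt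
  refine ((hσ.const_mul R).mul hκ).congr_deriv ?_
  have hσ0 := (F.σ_pos s).ne'
  rw [hode]
  field_simp
  ring

/-- If `W' = k(W² - 1)` with `W² > 1`, then `(W² - 1)^(-1/2)` has derivative
`-kW(W² - 1)^(-1/2)`. -/
lemma HasDerivAt.inv_sqrt_sq_sub_one {W : ℝ → ℝ} {k s : ℝ}
    (hW : HasDerivAt W (k * (W s ^ 2 - 1)) s) (h1 : 1 < W s ^ 2) :
    HasDerivAt (fun t => (Real.sqrt (W t ^ 2 - 1))⁻¹)
      (-(k * W s * (Real.sqrt (W s ^ 2 - 1))⁻¹)) s := by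
  have hpos : 0 < W s ^ 2 - 1 := by linarith
  have hN : Real.sqrt (W s ^ 2 - 1) ≠ 0 := (Real.sqrt_pos.2 hpos).ne'
  refine ((((hW.pow 2).sub_const 1).sqrt hpos.ne').inv hN).congr_deriv ?_
  have hsq := Real.sq_sqrt hpos.le
  simp only [Pi.pow_apply]
  rw [hsq]
  field_simp
  push_cast
  ring

lemma FrenetFrameM2.mink_smul_add_smul_self (F : FrenetFrameM2) (r w s : ℝ) :
    mink (r • (F.q s + w • F.h s)) (r • (F.q s + w • F.h s)) = r ^ 2 * (1 - w ^ 2) := by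
  have h1 := F.hqq s
  have h2 := F.hhh s
  have h3 := F.hqh s
  simp only [mink, Pi.smul_apply, Pi.add_apply, smul_eq_mul] at *
  linear_combination r ^ 2 * h1 + r ^ 2 * w ^ 2 * h2 + 2 * r ^ 2 * w * h3

/-- Theorem 5.2, sufficiency: if R²κ²σ² > 1 and κ' = (1/R)(R²κ²σ² - 1) - (σ'/σ)κ, then
c* = c + R a and q* = (q + Rσκ h)/√(R²σ²κ² - 1) define a developable timelike ruled
surface of type M₋¹ which is a Mannheim offset of the spacelike surface φ(s,v) = c(s) + v q(s). -/
theorem mannheim_offset_existence (F : FrenetFrameM2)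
    (c : ℝ → Fin 3 → ℝ) (hc : ContDiff ℝ (⊤ : ℕ∞) c)
    (hcq : ∀ s, deriv c s = F.q s)
    (R : ℝ) (hR : R ≠ 0)
    (hbig : ∀ s, 1 < R ^ 2 * F.κ s ^ 2 * F.σ s ^ 2)
    (hode : ∀ s, deriv F.κ s
      = (1 / R) * (R ^ 2 * F.κ s ^ 2 * F.σ s ^ 2 - 1) - (deriv F.σ s / F.σ s) * F.κ s)
    (qst : ℝ → Fin 3 → ℝ)
    (hqst : qst = fun s =>
      (Real.sqrt (R ^ 2 * F.σ s ^ 2 * F.κ s ^ 2 - 1))⁻¹ •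
        (F.q s + (R * F.σ s * F.κ s) • F.h s)) :
    (∀ s, mink (qst s) (qst s) = -1) ∧
    (∀ s, ∃ μ : ℝ, deriv (fun t => c t + R • F.a t) s = μ • qst s) ∧
    (∀ s, ∃ lam : ℝ, deriv qst s = lam • F.a s) := by
  have hW : ∀ s, R ^ 2 * F.σ s ^ 2 * F.κ s ^ 2 = (R * F.σ s * F.κ s) ^ 2 := fun s => by ring
  have hW1 : ∀ s, 1 < (R * F.σ s * F.κ s) ^ 2 := fun s => by
    linarith [hbig s, hW s]
  simp only [hW] at hqst
  subst hqst
  refine ⟨fun s => ?_, fun s => ⟨Real.sqrt ((R * F.σ s * F.κ s) ^ 2 - 1), ?_⟩,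
    fun s => ⟨(Real.sqrt ((R * F.σ s * F.κ s) ^ 2 - 1))⁻¹ *
      (R * F.σ s * F.κ s * F.σ s * F.κ s), ?_⟩⟩
  · have hpos : 0 < (R * F.σ s * F.κ s) ^ 2 - 1 := by linarith [hW1 s]
    rw [F.mink_smul_add_smul_self, inv_pow, Real.sq_sqrt hpos.le,
      ← neg_sub _ (1 : ℝ), mul_neg, inv_mul_cancel₀ hpos.ne']
  · have hpos : 0 < (R * F.σ s * F.κ s) ^ 2 - 1 := by linarith [hW1 s]
    have hc' := (hc.differentiable (by simp) s).hasDerivAt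
    have ha := (F.smooth_a.differentiable (by simp) s).hasDerivAt
    rw [smul_inv_smul₀ (Real.sqrt_pos.2 hpos).ne']
    refine (hc'.add (ha.const_smul R)).deriv.trans ?_
    rw [hcq, F.frenet_a, smul_smul, mul_assoc]
  · have hq := (F.smooth_q.differentiable (by simp) s).hasDerivAt
    have hh := (F.smooth_h.differentiable (by simp) s).hasDerivAt
    have hw := F.hasDerivAt_riccati hR (hode s)
    have hN := HasDerivAt.inv_sqrt_sq_sub_one hw (hW1 s)
    refine (hN.smul (hq.add (hw.smul hh))).deriv.trans ?_
    rw [F.frenet_q, F.frenet_h]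
    simp only [Pi.add_apply, Pi.smul_apply']
    module
end
end

section
/- Corollary 5.3 (b) (equations (35)–(36)): let q, h, a, σ, κ be a Frenet frame of a spacelike ruled surface of type M₊² and let θ : ℝ → ℝ be smooth with θ'(s) = -σ(s) for all s. Then for all s: (cosh θ(s) q(s) + sinh θ(s) h(s))' = σ(s) κ(s) sinh θ(s) a(s) and (sinh θ(s) q(s) + cosh θ(s) h(s))' = σ(s) κ(s) cosh θ(s) a(s). In particular, the derivative of the ruling a* of the trajectory ruled surface φ_{a*} of a Mannheim offset is parallel to a, so φ_{a*} is again a Mannheim offset of φ. -/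
noncomputable section

/-- Corollary 5.3 (b) (equations (35)–(36)): the derivatives of the asymptotic normals
a* = cosh θ q + sinh θ h and sinh θ q + cosh θ h of a Mannheim offset are parallel to a,
so the trajectory surface φ_{a*} is again a Mannheim offset of φ. -/
theorem trajectory_surface_mannheim_offset (F : FrenetFrameM2)
    (θ : ℝ → ℝ) (hθ : ContDiff ℝ (⊤ : ℕ∞) θ)
    (hθ' : ∀ s, deriv θ s = -F.σ s) :
    (∀ s, deriv (fun t => Real.cosh (θ t) • F.q t + Real.sinh (θ t) • F.h t) s
        = (F.σ s * F.κ s * Real.sinh (θ s)) • F.a s) ∧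
    (∀ s, deriv (fun t => Real.sinh (θ t) • F.q t + Real.cosh (θ t) • F.h t) s
        = (F.σ s * F.κ s * Real.cosh (θ s)) • F.a s) := by
  have hθd (s : ℝ) : HasDerivAt θ (-F.σ s) s :=
    hθ' s ▸ (hθ.differentiable (by simp) s).hasDerivAt
  have hq (s : ℝ) : HasDerivAt F.q (F.σ s • F.h s) s :=
    F.frenet_q s ▸ (F.smooth_q.differentiable (by simp) s).hasDerivAt
  have hh (s : ℝ) : HasDerivAt F.h (F.σ s • (F.q s + F.κ s • F.a s)) s :=
    F.frenet_h s ▸ (F.smooth_h.differentiable (by simp) s).hasDerivAt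
  constructor <;> intro s
  · refine (((hθd s).cosh.smul (hq s)).add ((hθd s).sinh.smul (hh s))).deriv.trans ?_
    module
  · refine (((hθd s).sinh.smul (hq s)).add ((hθd s).cosh.smul (hh s))).deriv.trans ?_
    module
end
end

section
/- Corollary 5.4 (b), type M₋¹ case (equation (40)): let q, h, a, σ, κ be a Frenet frame of a spacelike ruled surface of type M₊², let c : ℝ → ℝ³ be smooth with c'(s) = q(s) for all s, let R be a nonzero real constant with κ(s) ≠ 0 for all s, let θ : ℝ → ℝ be smooth with θ(s) ≠ 0 and θ'(s) = -σ(s) for all s, and set c*(s) = c(s) + R a(s) and a*(s) = cosh θ(s) q(s) + sinh θ(s) h(s) (the asymptotic normal of the Mannheim offset of type M₋¹). Then the trajectory ruled surface φ_{a*}(s,v) = c*(s) + v a*(s) is developable, i.e. det(c*'(s), a*(s), a*'(s)) = 0 for all s, if and only if -sinh θ(s) + R κ(s) σ(s) cosh θ(s) = 0 for all s. -/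
noncomputable section

/-- The Gram determinant identity for the Minkowski form: the form has determinant `-1`. -/
lemma det3_sq_eq_neg_gram (u v w : Fin 3 → ℝ) :
    det3 u v w ^ 2 =
      -(mink u u * (mink v v * mink w w - mink v w ^ 2)
        - mink u v * (mink u v * mink w w - mink v w * mink u w)
        + mink u w * (mink u v * mink v w - mink v v * mink u w)) := by
  simp only [det3, mink]
  ring

lemma FrenetFrameM2.det3_ne_zero (F : FrenetFrameM2) (s : ℝ) :
    det3 (F.q s) (F.h s) (F.a s) ≠ 0 := by
  intro h0
  have h := det3_sq_eq_neg_gram (F.q s) (F.h s) (F.a s)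
  rw [F.hqq, F.hhh, F.haa, F.hqh, F.hqa, F.hha, h0] at h
  norm_num at h

lemma det3_add_smul_smul (q h a : Fin 3 → ℝ) (r x y z : ℝ) :
    det3 (q + r • h) (x • q + y • h) (z • a) = (y - r * x) * z * det3 q h a := by
  simp only [det3, Pi.add_apply, Pi.smul_apply, smul_eq_mul]
  ring

/-- Corollary 5.4 (b), type M₋¹ case (equation (40)): the trajectory surface
φ_{a*}(s,v) = c*(s) + v a*(s) with a* = cosh θ q + sinh θ h is developable iff
-sinh θ + Rκσ cosh θ = 0. -/
theorem trajectory_surface_a_developable_M1minus (F : FrenetFrameM2)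
    (c : ℝ → Fin 3 → ℝ) (hc : ContDiff ℝ (⊤ : ℕ∞) c)
    (hcq : ∀ s, deriv c s = F.q s)
    (R : ℝ) (hR : R ≠ 0) (hκ : ∀ s, F.κ s ≠ 0)
    (θ : ℝ → ℝ) (hθ : ContDiff ℝ (⊤ : ℕ∞) θ) (hθ0 : ∀ s, θ s ≠ 0)
    (hθ' : ∀ s, deriv θ s = -F.σ s)
    (cst ast : ℝ → Fin 3 → ℝ)
    (hcst : cst = fun s => c s + R • F.a s)
    (hast : ast = fun s => Real.cosh (θ s) • F.q s + Real.sinh (θ s) • F.h s) :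
    (∀ s, det3 (deriv cst s) (ast s) (deriv ast s) = 0) ↔
      (∀ s, -Real.sinh (θ s) + R * F.κ s * F.σ s * Real.cosh (θ s) = 0) := by
  have hD {E : Type} [NormedAddCommGroup E] [NormedSpace ℝ E] {f : ℝ → E}
      (hf : ContDiff ℝ (⊤ : ℕ∞) f) (s : ℝ) : HasDerivAt f (deriv f s) s :=
    (hf.differentiable (by simp) s).hasDerivAt
  have hcst' (s : ℝ) : deriv cst s = F.q s + (R * (F.σ s * F.κ s)) • F.h s := by
    have h := (hD hc s).add ((hD F.smooth_a s).const_smul R)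
    rw [hcq, F.frenet_a, smul_smul] at h
    rw [hcst]
    exact h.deriv
  have hast' (s : ℝ) :
      deriv ast s = (F.σ s * F.κ s * Real.sinh (θ s)) • F.a s := by
    have h := ((hD hθ s).cosh.smul (hD F.smooth_q s)).add
      ((hD hθ s).sinh.smul (hD F.smooth_h s))
    rw [hθ', F.frenet_q, F.frenet_h] at h
    rw [hast]
    refine h.deriv.trans ?_
    module
  refine forall_congr' fun s => ?_
  have hdet : det3 (deriv cst s) (ast s) (deriv ast s) =
      (Real.sinh (θ s) - R * (F.σ s * F.κ s) * Real.cosh (θ s)) *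
        (F.σ s * F.κ s * Real.sinh (θ s)) * det3 (F.q s) (F.h s) (F.a s) := by
    rw [hcst', hast', hast]
    exact det3_add_smul_smul ..
  have hne : F.σ s * F.κ s * Real.sinh (θ s) ≠ 0 :=
    mul_ne_zero (mul_ne_zero (F.σ_pos s).ne' (hκ s)) (Real.sinh_ne_zero.mpr (hθ0 s))
  rw [hdet, mul_eq_zero_iff_right (F.det3_ne_zero s), mul_eq_zero_iff_right hne]
  constructor <;> intro h <;> linear_combination -h
end
end
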